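/- arXiv:2406.19810 — 2 statements merged into one kernel-verified Lean document; each statement's English description precedes it below -/
import Mathlib

section
/- Let (Ω, 𝓕, P, (𝓕_t)_{t=1}^N) be a filtered probability space, X = (X_t)_{t=1}^N an adapted process with values in Polish spaces, and U = (U_t)_{t=1}^N adapted with each U_t uniformly distributed on [0,1] and U_t independent of σ(X) ∨ 𝓕_{t-1}. If X is self-aware, i.e. the conditional law L(X | 𝓕_t) equals L(X | X_{1:t}) for all t, then the process (X_t, U_t)_{t=1}^N is also self-aware. -/
open MeasureTheory ProbabilityTheory

/-- The σ-algebra `σ(Y_{1:t})` generated by the process `Y` up to time `t`. -/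
def pathSigma {Ω E : Type*} {N : ℕ} [MeasurableSpace E] (Y : Fin N → Ω → E) (t : Fin N) :
    MeasurableSpace Ω :=
  ⨆ i : Fin N, ⨆ _ : i ≤ t, MeasurableSpace.comap (Y i) inferInstance

/-- A process `Y` adapted to a filtration `ℱ` is *self-aware* if the conditional law of the
whole path given `ℱ t` coincides with the conditional law given `Y_{1:t}`, for every `t`;
expressed via conditional expectations of indicators of path events. -/
def SelfAware {Ω E : Type*} {N : ℕ} [mΩ : MeasurableSpace Ω] [MeasurableSpace E]
    (μ : Measure Ω) (ℱ : Fin N → MeasurableSpace Ω) (Y : Fin N → Ω → E) : Prop :=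
  ∀ t : Fin N, ∀ s : Set (Fin N → E), MeasurableSet s →
    μ[Set.indicator ((fun ω i => Y i ω) ⁻¹' s) (fun _ => (1 : ℝ)) | ℱ t]
      =ᵐ[μ] μ[Set.indicator ((fun ω i => Y i ω) ⁻¹' s) (fun _ => (1 : ℝ)) | pathSigma Y t]


lemma measurable_pi_iff_aux {Ω E : Type*} {N : ℕ} {m : MeasurableSpace Ω} [MeasurableSpace E]
    {X : Fin N → Ω → E} (h : ∀ i, Measurable (X i)) {A : Set (Fin N → E)} (hA : MeasurableSet A) :
    MeasurableSet ((fun ω i => X i ω) ⁻¹' A) :=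
  measurable_pi_lambda _ h hA

lemma integrable_ind {Ω : Type*} [mΩ : MeasurableSpace Ω] (μ : Measure Ω) [IsProbabilityMeasure μ]
    {A : Set Ω} (hA : MeasurableSet A) : Integrable (A.indicator (fun _ => (1 : ℝ))) μ :=
  (integrable_const 1).indicator hA

lemma condExp_indep_inter {Ω : Type*} {m H K : MeasurableSpace Ω} [mΩ : MeasurableSpace Ω]
    (μ : Measure Ω) [IsProbabilityMeasure μ] (hm : m ≤ H) (hH : H ≤ mΩ) (hK : K ≤ mΩ)
    (hind : Indep K H μ) {C D : Set Ω} (hC : MeasurableSet[H] C) (hD : MeasurableSet[K] D) :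
    μ[(D ∩ C).indicator (fun _ => (1 : ℝ)) | m] =ᵐ[μ]
      (∫ ω, D.indicator (fun _ => (1 : ℝ)) ω ∂μ) • μ[C.indicator (fun _ => (1 : ℝ)) | m] := by
  set c := ∫ ω, D.indicator (fun _ => (1 : ℝ)) ω ∂μ with hc
  have h1 : μ[(D ∩ C).indicator (fun _ => (1 : ℝ)) | H] =ᵐ[μ]
      c • C.indicator (fun _ => (1 : ℝ)) := by
    rw [Set.inter_comm, ← Set.indicator_indicator]
    refine (condExp_indicator (integrable_ind μ (hK _ hD)) hC).trans ?_
    have h2 : μ[D.indicator (fun _ => (1 : ℝ)) | H] =ᵐ[μ] fun _ => c :=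
      condExp_indep_eq hK hH ((stronglyMeasurable_const).indicator hD) hind
    filter_upwards [h2] with ω hω
    by_cases h : ω ∈ C <;> simp [h, hω]
  refine (condExp_condExp_of_le hm hH).symm.trans ?_
  refine (condExp_congr_ae h1).trans ?_
  exact condExp_smul _ _ _

/-- base case -/
lemma condExp_le_of_eq {Ω : Type*} {F G G' : MeasurableSpace Ω} [mΩ : MeasurableSpace Ω]
    (μ : Measure Ω) [IsProbabilityMeasure μ] (hF : F ≤ mΩ) (hG : G ≤ F) (hG' : G' ≤ G)
    (f : Ω → ℝ) (h : μ[f | F] =ᵐ[μ] μ[f | G']) : μ[f | F] =ᵐ[μ] μ[f | G] := by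
  have h1 : μ[μ[f | F] | G] =ᵐ[μ] μ[f | G] := condExp_condExp_of_le hG hF
  have h2 : μ[μ[f | G'] | G] = μ[f | G'] :=
    condExp_of_stronglyMeasurable (hG.trans hF) (stronglyMeasurable_condExp.mono hG')
      integrable_condExp
  exact h.trans ((h2 ▸ (condExp_congr_ae h).symm).trans h1)

/-- λ-system extension -/
lemma condExp_iUnion {Ω : Type*} {m : MeasurableSpace Ω} [mΩ : MeasurableSpace Ω]
    (μ : Measure Ω) [IsProbabilityMeasure μ] (f : ℕ → Set Ω)
    (hf : Pairwise (Function.onFun Disjoint f)) (f_meas : ∀ i, MeasurableSet (f i)) :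
    μ[(⋃ i, f i).indicator (fun _ => (1 : ℝ)) | m] =ᵐ[μ]
      fun ω => ∑' i, μ[(f i).indicator (fun _ => (1 : ℝ)) | m] ω := by
  rw [indicator_iUnion_of_pairwise_disjoint _ hf]
  apply condExp_tsum (fun i ↦ ?_)
  · simp only [enorm_indicator_eq_indicator_enorm, enorm_one, f_meas,
            lintegral_indicator, lintegral_const, MeasurableSet.univ, Measure.restrict_apply,
            Set.univ_inter, one_mul, ne_eq, ← measure_iUnion hf f_meas, measure_ne_top,
            not_false_eq_true]
  · exact AEStronglyMeasurable.indicator (by fun_prop) (f_meas i)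

lemma condExp_compl {Ω : Type*} {m : MeasurableSpace Ω} [mΩ : MeasurableSpace Ω]
    (μ : Measure Ω) [IsProbabilityMeasure μ] (hm : m ≤ mΩ) {A : Set Ω} (hA : MeasurableSet A) :
    μ[Aᶜ.indicator (fun _ => (1 : ℝ)) | m] =ᵐ[μ]
      (fun _ => (1 : ℝ)) - μ[A.indicator (fun _ => (1 : ℝ)) | m] := by
  rw [Set.indicator_compl]
  refine (condExp_sub (integrable_const 1) (integrable_ind μ hA) m).trans ?_
  rw [condExp_const hm]

/-- If `X` is self-aware with respect to `(ℱ_t)` and each `U_t` is an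
`ℱ_t`-measurable uniform random variable on `[0,1]`, independent of `σ(X) ∨ ℱ_{t-1}`, then
the process `(X_t, U_t)_t` is also self-aware. -/
theorem stmt_6 {Ω E : Type*} [mΩ : MeasurableSpace Ω] [MeasurableSpace E] {N : ℕ}
    (μ : Measure Ω) [IsProbabilityMeasure μ]
    (ℱ : Fin N → MeasurableSpace Ω) (hmono : Monotone ℱ) (hle : ∀ t, ℱ t ≤ mΩ)
    (X : Fin N → Ω → E) (hX : ∀ t, Measurable[ℱ t] (X t))
    (U : Fin N → Ω → ℝ) (hUad : ∀ t, Measurable[ℱ t] (U t))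
    (hUunif : ∀ t, Measure.map (U t) μ = volume.restrict (Set.Icc 0 1))
    (hUindep : ∀ t : Fin N,
      Indep (MeasurableSpace.comap (U t) inferInstance)
        ((⨆ i : Fin N, MeasurableSpace.comap (X i) inferInstance) ⊔
          ⨆ i : Fin N, ⨆ _ : i < t, ℱ i) μ)
    (hsa : SelfAware μ ℱ X) :
    SelfAware μ ℱ (fun t ω => (X t ω, U t ω)) := by
  intro t s hs
  have hXm : ∀ i, Measurable (X i) := fun i => (hX i).mono (hle i) le_rfl
  have hUm : ∀ i, Measurable (U i) := fun i => (hUad i).mono (hle i) le_rfl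
  have hPm : Measurable (fun ω i => (X i ω, U i ω)) :=
    measurable_pi_lambda _ fun i => (hXm i).prodMk (hUm i)
  have hcomapG : ∀ i ≤ t, MeasurableSpace.comap (fun ω => (X i ω, U i ω)) inferInstance ≤ (pathSigma (fun t ω => (X t ω, U t ω)) t) :=
    fun i hi => le_iSup₂_of_le (f := fun i (_ : i ≤ t) =>
      MeasurableSpace.comap (fun ω => (X i ω, U i ω)) inferInstance) i hi le_rfl
  have hpG : ∀ i ≤ t, Measurable[(pathSigma (fun t ω => (X t ω, U t ω)) t)] (fun ω => (X i ω, U i ω)) := fun i hi =>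
    Measurable.of_comap_le (hcomapG i hi)
  have hGF : (pathSigma (fun t ω => (X t ω, U t ω)) t) ≤ ℱ t := by
    refine iSup₂_le fun i hi => Measurable.comap_le ?_
    exact ((hX i).prodMk (hUad i)).mono (hmono hi) le_rfl
  have hG' : pathSigma X t ≤ (pathSigma (fun t ω => (X t ω, U t ω)) t) := by
    refine iSup₂_le fun i hi => Measurable.comap_le ?_
    exact measurable_fst.comp (hpG i hi)
  have hGU : ∀ i ≤ t, Measurable[(pathSigma (fun t ω => (X t ω, U t ω)) t)] (U i) := fun i hi => measurable_snd.comp (hpG i hi)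
  -- key
  have key : ∀ (A : Set (Fin N → E)) (hA : MeasurableSet A) (B : Fin N → Set ℝ)
      (hB : ∀ i, MeasurableSet (B i)) (S : Finset (Fin N)),
      μ[((⋂ i ∈ S, U i ⁻¹' B i) ∩ (fun ω i => X i ω) ⁻¹' A).indicator (fun _ => (1 : ℝ)) | ℱ t]
      =ᵐ[μ]
      μ[((⋂ i ∈ S, U i ⁻¹' B i) ∩ (fun ω i => X i ω) ⁻¹' A).indicator (fun _ => (1 : ℝ)) | (pathSigma (fun t ω => (X t ω, U t ω)) t)] := by
    intro A hA B hB S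
    induction S using Finset.induction_on_max with
    | empty =>
      simp only [Finset.notMem_empty, Set.iInter_of_empty, Set.iInter_univ, Set.univ_inter]
      exact condExp_le_of_eq μ (hle t) hGF hG' _ (hsa t A hA)
    | insert a S ha ih =>
      rw [Finset.set_biInter_insert, Set.inter_assoc]
      set C := (⋂ i ∈ S, U i ⁻¹' B i) ∩ (fun ω i => X i ω) ⁻¹' A with hCdef
      have hCH : MeasurableSet[(⨆ i : Fin N, MeasurableSpace.comap (X i) inferInstance) ⊔
          ⨆ i : Fin N, ⨆ _ : i < a, ℱ i] C := by
        refine MeasurableSet.inter ?_ ?_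
        · refine Finset.measurableSet_biInter _ fun i hi => ?_
          have h1 : ℱ i ≤ (⨆ i : Fin N, MeasurableSpace.comap (X i) inferInstance) ⊔
              ⨆ i : Fin N, ⨆ _ : i < a, ℱ i :=
            (le_iSup₂_of_le (f := fun i (_ : i < a) => ℱ i) i (ha i hi) le_rfl).trans le_sup_right
          exact h1 _ (hUad i (hB i))
        · refine measurable_pi_iff_aux (fun i => ?_) hA
          exact Measurable.of_comap_le ((le_iSup (fun i =>
            MeasurableSpace.comap (X i) inferInstance) i).trans le_sup_left)
      have hHm : (⨆ i : Fin N, MeasurableSpace.comap (X i) inferInstance) ⊔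
          (⨆ i : Fin N, ⨆ _ : i < a, ℱ i) ≤ mΩ :=
        sup_le (iSup_le fun i => (hXm i).comap_le) (iSup₂_le fun i _ => hle i)
      rcases le_or_gt a t with hat | hat
      · have hCi := integrable_ind μ (hHm _ hCH)
        rw [← Set.indicator_indicator]
        refine (condExp_indicator hCi (hmono hat _ (hUad a (hB a)))).trans ?_
        refine Filter.EventuallyEq.trans ?_ (condExp_indicator hCi (hGU a hat (hB a))).symm
        filter_upwards [ih] with ω hω
        simp only [Set.indicator, hω]
      · have hFH : ℱ t ≤ (⨆ i : Fin N, MeasurableSpace.comap (X i) inferInstance) ⊔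
              ⨆ i : Fin N, ⨆ _ : i < a, ℱ i :=
            (le_iSup₂_of_le (f := fun i (_ : i < a) => ℱ i) t hat le_rfl).trans le_sup_right
        have hD : MeasurableSet[MeasurableSpace.comap (U a) inferInstance] (U a ⁻¹' B a) :=
          ⟨_, hB a, rfl⟩
        refine (condExp_indep_inter μ hFH hHm (hUm a).comap_le (hUindep a) hCH hD).trans ?_
        refine Filter.EventuallyEq.trans ?_ (condExp_indep_inter μ (hGF.trans hFH) hHm
          (hUm a).comap_le (hUindep a) hCH hD).symm
        filter_upwards [ih] with ω hω
        simp only [Pi.smul_apply, hω]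
  have hgen := generateFrom_eq_pi (ι := Fin N) (α := fun _ => E × ℝ)
    (fun _ => generateFrom_prod) (fun _ => isCountablySpanning_measurableSet.prod
      isCountablySpanning_measurableSet)
  have hpi := IsPiSystem.pi (ι := Fin N) (α := fun _ => E × ℝ)
    (fun _ => isPiSystem_prod (α := E) (β := ℝ))
  induction s, hs using MeasurableSpace.induction_on_inter hgen.symm hpi with
  | empty => simp
  | basic s hs =>
    obtain ⟨r, hr, rfl⟩ := hs
    have hr' : ∀ i, ∃ A : Set E, MeasurableSet A ∧ ∃ B : Set ℝ, MeasurableSet B ∧ A ×ˢ B = r i := by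
      intro i
      obtain ⟨A, hA, B, hB, h⟩ := hr i (Set.mem_univ i)
      exact ⟨A, hA, B, hB, h⟩
    choose A hA B hB hAB using hr'
    have := key (Set.univ.pi A) (MeasurableSet.univ_pi hA) B hB Finset.univ
    convert this using 3 <;>
    · ext ω
      simp only [Set.mem_preimage, Set.mem_pi, ← hAB, Set.mem_prod, Set.mem_inter_iff,
        Set.mem_iInter, Finset.mem_univ, Set.mem_univ, true_imp_iff, forall_and]
      tauto
  | compl s hs ih =>
    rw [Set.preimage_compl]
    refine (condExp_compl μ (hle t) (hPm hs)).trans ?_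
    refine Filter.EventuallyEq.trans ?_ (condExp_compl μ (hGF.trans (hle t)) (hPm hs)).symm
    filter_upwards [ih] with ω hω
    simp only [Pi.sub_apply, hω]
  | iUnion f hd hf ih =>
    rw [Set.preimage_iUnion]
    have hd' : Pairwise (Function.onFun Disjoint
        fun i => (fun ω i => (X i ω, U i ω)) ⁻¹' f i) :=
      fun i j hij => (hd hij).preimage _
    refine (condExp_iUnion μ _ hd' fun i => hPm (hf i)).trans ?_
    refine Filter.EventuallyEq.trans ?_ (condExp_iUnion μ _ hd' fun i => hPm (hf i)).symm
    filter_upwards [ae_all_iff.2 ih] with ω hω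
    exact tsum_congr hω
end

section
/- Let π be a coupling of filtered processes 𝕏 and 𝕐 (a probability measure on Ω^𝕏 × Ω^𝕐 with marginals P^𝕏 and P^𝕐). Then the following are equivalent: (i) for every t, 𝓕^𝕏_N ⊗ {∅,Ω^𝕐} and {∅,Ω^𝕏} ⊗ 𝓕^𝕐_t are conditionally independent given 𝓕^𝕏_t ⊗ {∅,Ω^𝕐} under π; (ii) E_π[U | 𝓕^𝕏_t ⊗ 𝓕^𝕐_t] = E_π[U | 𝓕^𝕏_t ⊗ {∅,Ω^𝕐}] for all t and all bounded 𝓕^𝕏_N-measurable U; (iii) E_π[V | 𝓕^𝕏_N ⊗ {∅,Ω^𝕐}] = E_π[V | 𝓕^𝕏_t ⊗ {∅,Ω^𝕐}] for all t and all bounded 𝓕^𝕐_t-measurable V. -/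
open MeasureTheory ProbabilityTheory

/-- Elementary conditional independence of two σ-algebras `mA, mB` given `mC` under `μ`:
`E[1_A 1_B | mC] = E[1_A | mC] · E[1_B | mC]` a.s. for all `A ∈ mA`, `B ∈ mB`. -/
def CondIndepC {Ω : Type*} [mΩ : MeasurableSpace Ω] (μ : Measure Ω)
    (mA mB mC : MeasurableSpace Ω) : Prop :=
  ∀ A : Set Ω, MeasurableSet[mA] A → ∀ B : Set Ω, MeasurableSet[mB] B →
    μ[Set.indicator (A ∩ B) (fun _ => (1 : ℝ)) | mC]
      =ᵐ[μ] μ[Set.indicator A (fun _ => (1 : ℝ)) | mC] *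
            μ[Set.indicator B (fun _ => (1 : ℝ)) | mC]

theorem aux_int {Ω : Type*} [mΩ : MeasurableSpace Ω] {μ : Measure Ω} {f : Ω → ℝ}
    (hf : Integrable f μ) {B : Set Ω} (hB : MeasurableSet B) :
    Integrable (f * B.indicator (fun _ => (1 : ℝ))) μ := by
  have : f * B.indicator (fun _ => (1 : ℝ)) = B.indicator f := by
    ext x; by_cases hx : x ∈ B <;> simp [hx]
  rw [this]; exact hf.indicator hB

theorem aux_one {Ω : Type*} {mB mC : MeasurableSpace Ω}
    [mΩ : MeasurableSpace Ω] {μ : Measure Ω} [IsProbabilityMeasure μ] (hB : mB ≤ mΩ) (hC : mC ≤ mΩ) {f : Ω → ℝ} (hf : Integrable f μ)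
    (H : ∀ B, MeasurableSet[mB] B → μ[f * B.indicator (fun _ => (1 : ℝ)) | mC] =ᵐ[μ]
      μ[f | mC] * μ[B.indicator (fun _ => (1 : ℝ)) | mC]) :
    μ[f | mC ⊔ mB] =ᵐ[μ] μ[f | mC] := by
  have hle : mC ⊔ mB ≤ mΩ := sup_le hC hB
  have hmulB : ∀ (g : Ω → ℝ) (B : Set Ω), g * B.indicator (fun _ => (1 : ℝ)) = B.indicator g := by
    intro g B; ext x; by_cases hx : x ∈ B <;> simp [hx]
  symm
  refine ae_eq_condExp_of_forall_setIntegral_eq hle hf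
    (fun s _ _ => integrable_condExp.integrableOn) ?_
    (StronglyMeasurable.aestronglyMeasurable
      ((stronglyMeasurable_condExp (m := mC)).mono (le_sup_left : mC ≤ mC ⊔ mB)))
  intro s hs _
  let S : Set (Set Ω) := {s | ∃ c b, MeasurableSet[mC] c ∧ MeasurableSet[mB] b ∧ s = c ∩ b}
  have hgen : mC ⊔ mB = MeasurableSpace.generateFrom S := by
    apply le_antisymm
    · refine sup_le ?_ ?_
      · intro c hc
        exact MeasurableSpace.measurableSet_generateFrom
          ⟨c, Set.univ, hc, MeasurableSet.univ, by simp⟩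
      · intro b hb
        exact MeasurableSpace.measurableSet_generateFrom
          ⟨Set.univ, b, MeasurableSet.univ, hb, by simp⟩
    · refine MeasurableSpace.generateFrom_le ?_
      rintro _ ⟨c, b, hc, hb, rfl⟩
      have h1 : MeasurableSet[mC ⊔ mB] c := (le_sup_left : mC ≤ mC ⊔ mB) c hc
      have h2 : MeasurableSet[mC ⊔ mB] b := (le_sup_right : mB ≤ mC ⊔ mB) b hb
      exact @MeasurableSet.inter _ (mC ⊔ mB) _ _ h1 h2
  have hpi : IsPiSystem S := by
    rintro _ ⟨c, b, hc, hb, rfl⟩ _ ⟨c', b', hc', hb', rfl⟩ _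
    exact ⟨c ∩ c', b ∩ b', @MeasurableSet.inter _ mC _ _ hc hc',
      @MeasurableSet.inter _ mB _ _ hb hb', Set.inter_inter_inter_comm _ _ _ _⟩
  have hgi : Integrable (μ[f | mC]) μ := integrable_condExp
  induction s, hs using MeasurableSpace.induction_on_inter hgen hpi with
  | empty => simp
  | basic s hs =>
    obtain ⟨c, b, hc, hb, rfl⟩ := hs
    have hb' := hB b hb
    rw [← setIntegral_indicator hb', ← setIntegral_indicator hb', ← hmulB (μ[f | mC]) b,
      ← hmulB f b,
      ← setIntegral_condExp hC (aux_int hf hb') hc, ← setIntegral_condExp hC (aux_int hgi hb') hc]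
    refine setIntegral_congr_ae (hC c hc) ?_
    have h2 : μ[μ[f | mC] * b.indicator (fun _ => (1 : ℝ)) | mC] =ᵐ[μ]
        μ[f | mC] * μ[b.indicator (fun _ => (1 : ℝ)) | mC] :=
      condExp_mul_of_stronglyMeasurable_left stronglyMeasurable_condExp (aux_int hgi hb')
        ((integrable_const 1).indicator hb')
    filter_upwards [H b hb, h2] with x h1 h2 _
    rw [h1, h2]
  | compl s hs ih =>
    have hs' := hle s hs
    have e1 := integral_add_compl hs' hgi
    have e2 := integral_add_compl hs' hf
    have e3 := integral_condExp (f := f) hC (μ := μ)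
    have := ih (measure_lt_top _ _)
    linarith
  | iUnion g hd hg ih =>
    rw [integral_iUnion (fun i => hle _ (hg i)) hd hgi.integrableOn,
      integral_iUnion (fun i => hle _ (hg i)) hd hf.integrableOn]
    congr 1; ext i; exact ih i (measure_lt_top _ _)

theorem aux_two {Ω : Type*} {mA mC : MeasurableSpace Ω}
    [mΩ : MeasurableSpace Ω] {μ : Measure Ω} [IsProbabilityMeasure μ] (hA : mA ≤ mΩ) (hC : mC ≤ mΩ) {f : Ω → ℝ} (hf : Integrable f μ)
    (hfm : StronglyMeasurable[mA] f) {B : Set Ω} (hB : MeasurableSet B)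
    (H : μ[B.indicator (fun _ => (1 : ℝ)) | mC ⊔ mA] =ᵐ[μ] μ[B.indicator (fun _ => (1 : ℝ)) | mC]) :
    μ[f * B.indicator (fun _ => (1 : ℝ)) | mC] =ᵐ[μ]
      μ[f | mC] * μ[B.indicator (fun _ => (1 : ℝ)) | mC] := by
  have hle : mC ⊔ mA ≤ mΩ := sup_le hC hA
  have hBi : Integrable (B.indicator (fun _ => (1 : ℝ))) μ := (integrable_const 1).indicator hB
  have h1 : μ[f * B.indicator (fun _ => (1 : ℝ)) | mC ⊔ mA] =ᵐ[μ]
      f * μ[B.indicator (fun _ => (1 : ℝ)) | mC] := by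
    refine (condExp_mul_of_stronglyMeasurable_left (hfm.mono (le_sup_right : mA ≤ mC ⊔ mA))
      (aux_int hf hB) hBi).trans ?_
    filter_upwards [H] with x hx
    simp [hx]
  have hint : Integrable (f * μ[B.indicator (fun _ => (1 : ℝ)) | mC]) μ :=
    integrable_condExp.congr h1
  calc μ[f * B.indicator (fun _ => (1 : ℝ)) | mC]
      =ᵐ[μ] μ[μ[f * B.indicator (fun _ => (1 : ℝ)) | mC ⊔ mA] | mC] :=
        (condExp_condExp_of_le le_sup_left hle).symm
    _ =ᵐ[μ] μ[f * μ[B.indicator (fun _ => (1 : ℝ)) | mC] | mC] := condExp_congr_ae h1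
    _ =ᵐ[μ] _ := condExp_mul_of_stronglyMeasurable_right stronglyMeasurable_condExp hint hf

theorem aux_ind {Ω : Type*} (A B : Set Ω) : (A ∩ B).indicator (fun _ => (1 : ℝ)) =
    A.indicator (fun _ => (1 : ℝ)) * B.indicator (fun _ => (1 : ℝ)) := by
  ext x; by_cases hx : x ∈ A <;> by_cases hy : x ∈ B <;> simp [hx, hy]

theorem aux_symm {Ω : Type*} {mA mB mC : MeasurableSpace Ω}
    [mΩ : MeasurableSpace Ω] {μ : Measure Ω} (h : CondIndepC μ mA mB mC) : CondIndepC μ mB mA mC := by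
  intro B hB A hA
  rw [Set.inter_comm, mul_comm]
  exact h A hA B hB

theorem aux_fwd {Ω : Type*} {mA mB mC : MeasurableSpace Ω}
    [mΩ : MeasurableSpace Ω] {μ : Measure Ω} [IsProbabilityMeasure μ] (hA : mA ≤ mΩ) (hB : mB ≤ mΩ) (hC : mC ≤ mΩ)
    (h : CondIndepC μ mA mB mC) {f : Ω → ℝ} (hf : Integrable f μ)
    (hfm : StronglyMeasurable[mA] f) : μ[f | mC ⊔ mB] =ᵐ[μ] μ[f | mC] := by
  refine aux_one hB hC hf fun B hBm => ?_
  refine aux_two hA hC hf hfm (hB B hBm) ?_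
  refine aux_one hA hC ((integrable_const 1).indicator (hB B hBm)) fun A hAm => ?_
  rw [← aux_ind]
  exact aux_symm h B hBm A hAm

theorem aux_bwd {Ω : Type*} {mA mB mC : MeasurableSpace Ω}
    [mΩ : MeasurableSpace Ω] {μ : Measure Ω} [IsProbabilityMeasure μ] (hA : mA ≤ mΩ) (hB : mB ≤ mΩ) (hC : mC ≤ mΩ)
    (h : ∀ B, MeasurableSet[mB] B → μ[B.indicator (fun _ => (1 : ℝ)) | mC ⊔ mA] =ᵐ[μ]
      μ[B.indicator (fun _ => (1 : ℝ)) | mC]) : CondIndepC μ mA mB mC := by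
  intro A hAm B hBm
  rw [aux_ind]
  exact aux_two hA hC ((integrable_const 1).indicator (hA A hAm))
    (Measurable.stronglyMeasurable (Measurable.indicator (m := mA) measurable_const hAm)) (hB B hBm) (h B hBm)

theorem aux_bdd {Ω : Type*} [mΩ : MeasurableSpace Ω] {μ : Measure Ω} [IsProbabilityMeasure μ]
    {f : Ω → ℝ} (hf : Measurable f) (hb : ∃ C, ∀ ω, |f ω| ≤ C) : Integrable f μ := by
  obtain ⟨C, hC⟩ := hb
  exact Integrable.of_bound hf.aestronglyMeasurable C (ae_of_all _ hC)

theorem aux_indbdd {Ω : Type*} (A : Set Ω) :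
    ∃ C, ∀ ω, |A.indicator (fun _ => (1 : ℝ)) ω| ≤ C := by
  refine ⟨1, fun x => ?_⟩
  by_cases hx : x ∈ A <;> simp [hx]


/-- (Lemma 2.9: characterizations of causality.) For a coupling `π` of
filtered probability spaces `(Ω₁, ℱ)` and `(Ω₂, 𝒢)` with `N` time steps, the following are
equivalent: (i) for every `t ≤ N`, `ℱ_N ⊗ triv` and `triv ⊗ 𝒢_t` are conditionally
independent given `ℱ_t ⊗ triv`; (ii) `E_π[U | ℱ_t ⊗ 𝒢_t] = E_π[U | ℱ_t ⊗ triv]` for all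
`t ≤ N` and bounded `ℱ_N`-measurable `U`; (iii) `E_π[V | ℱ_N ⊗ triv] = E_π[V | ℱ_t ⊗ triv]`
for all `t ≤ N` and bounded `𝒢_t`-measurable `V`. -/
theorem stmt_9 {Ω₁ Ω₂ : Type*} [m₁ : MeasurableSpace Ω₁] [m₂ : MeasurableSpace Ω₂] {N : ℕ}
    (ℱ : ℕ → MeasurableSpace Ω₁) (hFmono : Monotone ℱ) (hFle : ∀ t, ℱ t ≤ m₁)
    (𝒢 : ℕ → MeasurableSpace Ω₂) (hGmono : Monotone 𝒢) (hGle : ∀ t, 𝒢 t ≤ m₂)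
    (P₁ : Measure Ω₁) [IsProbabilityMeasure P₁] (P₂ : Measure Ω₂) [IsProbabilityMeasure P₂]
    (π : Measure (Ω₁ × Ω₂)) [IsProbabilityMeasure π]
    (hπ₁ : Measure.map Prod.fst π = P₁) (hπ₂ : Measure.map Prod.snd π = P₂) :
    ((∀ t ≤ N, CondIndepC π (MeasurableSpace.comap Prod.fst (ℱ N))
        (MeasurableSpace.comap Prod.snd (𝒢 t)) (MeasurableSpace.comap Prod.fst (ℱ t))) ↔
      (∀ t ≤ N, ∀ U : Ω₁ → ℝ, Measurable[ℱ N] U → (∃ C, ∀ ω, |U ω| ≤ C) →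
        π[(fun p : Ω₁ × Ω₂ => U p.1) |
            MeasurableSpace.comap Prod.fst (ℱ t) ⊔ MeasurableSpace.comap Prod.snd (𝒢 t)]
          =ᵐ[π] π[(fun p : Ω₁ × Ω₂ => U p.1) | MeasurableSpace.comap Prod.fst (ℱ t)])) ∧
    ((∀ t ≤ N, CondIndepC π (MeasurableSpace.comap Prod.fst (ℱ N))
        (MeasurableSpace.comap Prod.snd (𝒢 t)) (MeasurableSpace.comap Prod.fst (ℱ t))) ↔
      (∀ t ≤ N, ∀ V : Ω₂ → ℝ, Measurable[𝒢 t] V → (∃ C, ∀ ω, |V ω| ≤ C) →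
        π[(fun p : Ω₁ × Ω₂ => V p.2) | MeasurableSpace.comap Prod.fst (ℱ N)]
          =ᵐ[π] π[(fun p : Ω₁ × Ω₂ => V p.2) | MeasurableSpace.comap Prod.fst (ℱ t)])) := by
  have hA : ∀ t, MeasurableSpace.comap (Prod.fst : Ω₁ × Ω₂ → Ω₁) (ℱ t) ≤ Prod.instMeasurableSpace :=
    fun t => (MeasurableSpace.comap_mono (hFle t)).trans measurable_fst.comap_le
  have hB : ∀ t, MeasurableSpace.comap (Prod.snd : Ω₁ × Ω₂ → Ω₂) (𝒢 t) ≤ Prod.instMeasurableSpace :=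
    fun t => (MeasurableSpace.comap_mono (hGle t)).trans measurable_snd.comap_le
  have hsup : ∀ t ≤ N, MeasurableSpace.comap (Prod.fst : Ω₁ × Ω₂ → Ω₁) (ℱ t) ⊔
      MeasurableSpace.comap (Prod.fst : Ω₁ × Ω₂ → Ω₁) (ℱ N) =
      MeasurableSpace.comap (Prod.fst : Ω₁ × Ω₂ → Ω₁) (ℱ N) :=
    fun t ht => sup_eq_right.2 (MeasurableSpace.comap_mono (hFmono ht))
  refine ⟨⟨?_, ?_⟩, ⟨?_, ?_⟩⟩
  · intro h t ht U hU hb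
    have hm : Measurable[MeasurableSpace.comap (Prod.fst : Ω₁ × Ω₂ → Ω₁) (ℱ N)]
        (fun p : Ω₁ × Ω₂ => U p.1) := hU.comp (comap_measurable _)
    refine aux_fwd (hA N) (hB t) (hA t) (h t ht) (aux_bdd (hm.mono (hA N) le_rfl) ?_)
      hm.stronglyMeasurable
    obtain ⟨C, hC⟩ := hb
    exact ⟨C, fun ω => hC ω.1⟩
  · intro h t ht
    refine aux_symm (aux_bwd (μ := π) (hB t) (hA N) (hA t) ?_)
    rintro _ ⟨A, hAm, rfl⟩
    exact h t ht (A.indicator fun _ => 1)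
      (Measurable.indicator (m := _) measurable_const hAm) (aux_indbdd A)
  · intro h t ht V hV hb
    have hm : Measurable[MeasurableSpace.comap (Prod.snd : Ω₁ × Ω₂ → Ω₂) (𝒢 t)]
        (fun p : Ω₁ × Ω₂ => V p.2) := hV.comp (comap_measurable _)
    have := aux_fwd (hB t) (hA N) (hA t) (aux_symm (h t ht))
      (aux_bdd (hm.mono (hB t) le_rfl) (by
        obtain ⟨C, hC⟩ := hb
        exact ⟨C, fun ω => hC ω.2⟩)) hm.stronglyMeasurable
    rwa [hsup t ht] at this
  · intro h t ht
    refine aux_bwd (hA N) (hB t) (hA t) ?_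
    rintro _ ⟨B, hBm, rfl⟩
    rw [hsup t ht]
    exact h t ht (B.indicator fun _ => 1)
      (Measurable.indicator (m := _) measurable_const hBm) (aux_indbdd B)
end
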